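/- Let C₁, C₂ > 0, let d ≥ 1, and let N ≥ C₁ d be such that #(B_N ∩ ℤ^d) ≥ C₂^{−1} |B_N|. Let f : ℤ^d → ℝ be nonnegative, let F(x) = ∑_{y ∈ ℤ^d} f(y) χ_{y + Q_{1/2}}(x) be its step extension to ℝ^d, and set N₂ = (N² + d/2)^{1/2}. Then for every x ∈ ℤ^d, M_N^B f(x) ≤ 4 C₂ e^{1/(4C₁²)} ∫_{x + Q_{1/2}} 𝐌_{N₂}^B F(y) dy. (Inequality (3.16) in the proof of Theorem 1.2.) -/

import Mathlib

open MeasureTheory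

/-- The set of lattice points in the closed Euclidean ball of radius `N`
centered at the origin of `ℝ^d`. -/
def latticeBallSet (d : ℕ) (N : ℝ) : Set (Fin d → ℤ) :=
  {y | ∑ j, ((y j : ℝ)) ^ 2 ≤ N ^ 2}

/-- The closed Euclidean ball of radius `N` centered at the origin of `ℝ^d`. -/
def euclideanBall (d : ℕ) (N : ℝ) : Set (Fin d → ℝ) :=
  {x | ∑ j, (x j) ^ 2 ≤ N ^ 2}

/-- The discrete Hardy–Littlewood averaging operator (real-valued):
`M_N^B f (x) = (1/#(B_N ∩ ℤ^d)) ∑_{y ∈ B_N ∩ ℤ^d} f (x - y)`. -/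
noncomputable def ballAvgR (d : ℕ) (N : ℝ) (f : (Fin d → ℤ) → ℝ) (x : Fin d → ℤ) : ℝ :=
  (∑ᶠ y ∈ latticeBallSet d N, f (x - y)) / ((latticeBallSet d N).ncard : ℝ)

/-- The step extension of `f : ℤ^d → ℝ` to `ℝ^d`:
`F(x) = ∑_{y ∈ ℤ^d} f(y) χ_{y + Q_{1/2}}(x)` with `Q_{1/2} = [-1/2, 1/2]^d`. -/
noncomputable def stepExt (d : ℕ) (f : (Fin d → ℤ) → ℝ) (x : Fin d → ℝ) : ℝ :=
  ∑' y : Fin d → ℤ,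
    f y * Set.indicator
      (Set.Icc (fun j => (y j : ℝ) - 1 / 2) (fun j => (y j : ℝ) + 1 / 2))
      (fun _ => (1 : ℝ)) x

/-- The continuous Hardy–Littlewood averaging operator over the Euclidean
ball: `𝐌_t^B F (x) = (1/|B_t|) ∫_{B_t} F (x + z) dz`. -/
noncomputable def contBallAvg (d : ℕ) (t : ℝ) (F : (Fin d → ℝ) → ℝ) (x : Fin d → ℝ) : ℝ :=
  (∫ z in euclideanBall d t, F (x + z)) / (volume (euclideanBall d t)).toReal

/-- The uniform probability measure on the cube `[-1/2, 1/2]^d`. -/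
noncomputable def cubeMeasure (d : ℕ) : Measure (Fin d → ℝ) :=
  Measure.pi fun _ => volume.restrict (Set.Icc (-1 / 2 : ℝ) (1 / 2))

instance isProbabilityMeasure_restrict_Icc_half :
    IsProbabilityMeasure (volume.restrict (Set.Icc (-1 / 2 : ℝ) (1 / 2))) :=
  ⟨by simp; norm_num⟩

instance isProbabilityMeasure_cubeMeasure (d : ℕ) : IsProbabilityMeasure (cubeMeasure d) := by
  unfold cubeMeasure; infer_instance

lemma cubeMeasure_eq_restrict (d : ℕ) :
    cubeMeasure d = volume.restrict (Set.Icc (fun _ => (-1 / 2 : ℝ)) (fun _ => 1 / 2)) := by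
  rw [cubeMeasure, ← Measure.restrict_pi_pi, Set.pi_univ_Icc]
  rfl

lemma setIntegral_Icc_eq_integral_cubeMeasure {d : ℕ} (a : Fin d → ℝ) (g : (Fin d → ℝ) → ℝ) :
    ∫ y in Set.Icc (fun j => a j - 1 / 2) (fun j => a j + 1 / 2), g y =
      ∫ u, g (a + u) ∂cubeMeasure d := by
  rw [cubeMeasure_eq_restrict, ← (measurePreserving_add_left volume a).setIntegral_preimage_emb
    (measurableEmbedding_addLeft a)]
  congr 2
  ext u
  simp only [Set.mem_preimage, Set.mem_Icc, Pi.le_def, Pi.add_apply]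
  refine and_congr (forall_congr' fun i => ?_) (forall_congr' fun i => ?_) <;>
    constructor <;> intro h <;> linarith

lemma isClosed_euclideanBall (d : ℕ) (r : ℝ) : IsClosed (euclideanBall d r) :=
  isClosed_le (by fun_prop) (by fun_prop)

lemma abs_apply_le_of_mem_euclideanBall {d : ℕ} {r : ℝ} (hr : 0 ≤ r) {z : Fin d → ℝ}
    (hz : z ∈ euclideanBall d r) (j : Fin d) : |z j| ≤ r :=
  abs_le_of_sq_le_sq
    ((Finset.single_le_sum (fun i _ => sq_nonneg (z i)) (Finset.mem_univ j)).trans hz) hr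

lemma volume_euclideanBall_lt_top (d : ℕ) {r : ℝ} (hr : 0 ≤ r) :
    volume (euclideanBall d r) < ⊤ := by
  refine (measure_mono ?_).trans_lt
    (isCompact_Icc (a := fun _ : Fin d => -r) (b := fun _ => r)).measure_lt_top
  exact fun z hz => ⟨fun j => (abs_le.1 (abs_apply_le_of_mem_euclideanBall hr hz j)).1,
    fun j => (abs_le.1 (abs_apply_le_of_mem_euclideanBall hr hz j)).2⟩

lemma volume_euclideanBall_pos (d : ℕ) {r : ℝ} (hr : 0 < r) :
    0 < volume (euclideanBall d r) := by
  have ho : IsOpen {x : Fin d → ℝ | ∑ j, (x j) ^ 2 < r ^ 2} :=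
    isOpen_lt (by fun_prop) (by fun_prop)
  refine (ho.measure_pos volume ⟨0, ?_⟩).trans_le (measure_mono fun x hx => ?_)
  · simpa using pow_pos hr 2
  · have h : ∑ j, (x j) ^ 2 < r ^ 2 := hx
    exact h.le

open scoped Pointwise in
lemma volume_euclideanBall_mul (d : ℕ) {c : ℝ} (hc : 0 < c) (r : ℝ) :
    (volume (euclideanBall d (c * r))).toReal = c ^ d * (volume (euclideanBall d r)).toReal := by
  have h : euclideanBall d (c * r) = c • euclideanBall d r := by
    ext x
    rw [Set.mem_smul_set_iff_inv_smul_mem₀ hc.ne']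
    simp only [euclideanBall, Set.mem_ofPred_eq, Pi.smul_apply, smul_eq_mul, mul_pow,
      ← Finset.mul_sum, inv_pow]
    rw [inv_mul_le_iff₀ (by positivity)]
  rw [h, Measure.addHaar_smul, ENNReal.toReal_mul, ENNReal.toReal_ofReal (abs_nonneg _),
    abs_of_nonneg (by positivity)]
  simp

/-- Enlarging the squared radius by `d / 2` costs at most a factor `exp (1 / (4 C²))`
in volume once `r ≥ C d`. -/
lemma volume_euclideanBall_sqrt_le {C : ℝ} (hC : 0 < C) {d : ℕ} (hd : 1 ≤ d) {r : ℝ}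
    (hr : C * (d : ℝ) ≤ r) :
    (volume (euclideanBall d (Real.sqrt (r ^ 2 + (d : ℝ) / 2)))).toReal ≤
      Real.exp (1 / (4 * C ^ 2)) * (volume (euclideanBall d r)).toReal := by
  have hd' : (0 : ℝ) < d := by exact_mod_cast hd
  have hr0 : 0 < r := (mul_pos hC hd').trans_le hr
  set c := Real.sqrt (1 + d / (2 * r ^ 2)) with hc
  have hcr : Real.sqrt (r ^ 2 + (d : ℝ) / 2) = c * r := by
    rw [hc, ← Real.sqrt_sq hr0.le, ← Real.sqrt_mul (by positivity), Real.sqrt_sq hr0.le]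
    congr 1
    field_simp
  have hc0 : 0 < c := Real.sqrt_pos.2 (by positivity)
  rw [hcr, volume_euclideanBall_mul d hc0]
  refine mul_le_mul_of_nonneg_right ?_ ENNReal.toReal_nonneg
  have h1 : c ≤ Real.exp (d / (4 * r ^ 2)) := by
    rw [hc, Real.sqrt_le_left (Real.exp_pos _).le, ← Real.exp_nat_mul]
    refine (add_comm _ _).trans_le ((Real.add_one_le_exp _).trans_eq ?_)
    congr 1
    push_cast
    field_simp
    norm_num
  calc c ^ d ≤ Real.exp (d / (4 * r ^ 2)) ^ d := pow_le_pow_left₀ hc0.le h1 d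
    _ = Real.exp (d ^ 2 / (4 * r ^ 2)) := by
      rw [← Real.exp_nat_mul]
      congr 1
      ring
    _ ≤ Real.exp (1 / (4 * C ^ 2)) := by
      rw [Real.exp_le_exp, div_le_div_iff₀ (by positivity) (by positivity)]
      have := pow_le_pow_left₀ (by positivity) hr 2
      nlinarith

lemma integrable_of_continuous_cubeMeasure {d : ℕ}
    {g : (Fin d → ℝ) × (Fin d → ℝ) → ℝ} (hg : Continuous g) :
    Integrable g ((cubeMeasure d).prod (cubeMeasure d)) := by
  rw [cubeMeasure_eq_restrict, Measure.prod_restrict]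
  exact hg.continuousOn.integrableOn_compact (isCompact_Icc.prod isCompact_Icc)

lemma integral_sub_sq_cubeMeasure {d : ℕ} (j : Fin d) :
    ∫ p : (Fin d → ℝ) × (Fin d → ℝ), (p.2 j - p.1 j) ^ 2
      ∂(cubeMeasure d).prod (cubeMeasure d) = 1 / 6 := by
  have hev (g : ℝ → ℝ) (hg : Continuous g) :
      ∫ u : Fin d → ℝ, g (u j) ∂cubeMeasure d = ∫ t in (-1 / 2 : ℝ)..(1 / 2), g t := by
    rw [intervalIntegral.integral_of_le (by norm_num), ← integral_Icc_eq_integral_Ioc]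
    exact integral_comp_eval (μ := fun _ : Fin d => volume.restrict (Set.Icc (-1 / 2 : ℝ) (1 / 2)))
      hg.aestronglyMeasurable
  rw [integral_prod _ (integrable_of_continuous_cubeMeasure (by fun_prop))]
  have hinner (s : ℝ) : ∫ t in (-1 / 2 : ℝ)..(1 / 2), (t - s) ^ 2 = 1 / 12 + s ^ 2 := by
    rw [intervalIntegral.integral_comp_sub_right (fun t => t ^ 2), integral_pow]
    norm_num
    ring
  have h1 (u : Fin d → ℝ) : ∫ v : Fin d → ℝ, (v j - u j) ^ 2 ∂cubeMeasure d
      = 1 / 12 + (u j) ^ 2 := by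
    rw [hev (fun t => (t - u j) ^ 2) (by fun_prop), hinner]
  simp only [h1]
  rw [hev (fun t => 1 / 12 + t ^ 2) (by fun_prop), intervalIntegral.integral_add (by simp)
    (Continuous.intervalIntegrable (by fun_prop) _ _), integral_pow]
  norm_num

lemma integrable_indicator_add_sub {d : ℕ} {B : Set (Fin d → ℝ)} (hB : MeasurableSet B)
    (k : Fin d → ℝ) :
    Integrable (fun p : (Fin d → ℝ) × (Fin d → ℝ) =>
      B.indicator (fun _ => (1 : ℝ)) (k + p.2 - p.1))
      ((cubeMeasure d).prod (cubeMeasure d)) := by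
  have hm : MeasurableSet {p : (Fin d → ℝ) × (Fin d → ℝ) | k + p.2 - p.1 ∈ B} :=
    (show Measurable fun p : (Fin d → ℝ) × (Fin d → ℝ) => k + p.2 - p.1 by fun_prop) hB
  exact (integrable_const (1 : ℝ)).indicator hm

/-- If `|k| ≤ r` and `u`, `v` are independent and uniform on the unit cube, then
`|k + v - u|² ≤ r² + d / 2` with probability at least `1 / 4`. -/
lemma one_div_four_le_integral_indicator {d : ℕ} (hd : 1 ≤ d) {r : ℝ} {k : Fin d → ℝ}
    (hk : k ∈ euclideanBall d r) :
    1 / 4 ≤ ∫ u, ∫ v, (euclideanBall d (Real.sqrt (r ^ 2 + (d : ℝ) / 2))).indicator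
      (fun _ => (1 : ℝ)) (k + v - u) ∂cubeMeasure d ∂cubeMeasure d := by
  have hd' : (0 : ℝ) < d := by exact_mod_cast hd
  set B := euclideanBall d (Real.sqrt (r ^ 2 + (d : ℝ) / 2)) with hB
  set g : (Fin d → ℝ) × (Fin d → ℝ) → ℝ :=
    fun p => B.indicator (fun _ => (1 : ℝ)) (k + p.2 - p.1) with hg
  have hgi : Integrable g ((cubeMeasure d).prod (cubeMeasure d)) :=
    integrable_indicator_add_sub (isClosed_euclideanBall d _).measurableSet k
  have hmem (w : Fin d → ℝ) (h1 : ∑ j, k j * w j ≤ 0) (h2 : ∑ j, (w j) ^ 2 ≤ d / 2) :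
      k + w ∈ B := by
    rw [hB, euclideanBall, Set.mem_ofPred_eq, Real.sq_sqrt (by positivity)]
    have hk' : ∑ j, (k j) ^ 2 ≤ r ^ 2 := hk
    have : ∑ j, ((k + w) j) ^ 2 =
        ∑ j, (k j) ^ 2 + 2 * ∑ j, k j * w j + ∑ j, (w j) ^ 2 := by
      rw [Finset.mul_sum, ← Finset.sum_add_distrib, ← Finset.sum_add_distrib]
      exact Finset.sum_congr rfl fun j _ => by simp only [Pi.add_apply]; ring
    linarith
  have hg0 (p) : 0 ≤ g p := Set.indicator_nonneg (fun _ _ => zero_le_one) _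
  have hpt (p : (Fin d → ℝ) × (Fin d → ℝ)) :
      1 - 2 / d * ∑ j, (p.2 j - p.1 j) ^ 2 ≤ g p + g p.swap := by
    by_cases h : ∑ j, (p.2 j - p.1 j) ^ 2 ≤ d / 2
    · have hS : 0 ≤ 2 / (d : ℝ) * ∑ j, (p.2 j - p.1 j) ^ 2 := by positivity
      rcases le_total (∑ j, k j * (p.2 - p.1) j) 0 with h1 | h1
      · have : g p = 1 := by
          simp only [hg, add_sub_assoc]
          exact Set.indicator_of_mem (hmem _ h1 h) _
        linarith [hg0 p.swap]
      · have : g p.swap = 1 := by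
          simp only [hg, add_sub_assoc]
          refine Set.indicator_of_mem (hmem _ ?_ ?_) _
          · have : ∑ j, k j * (p.swap.2 - p.swap.1) j = - ∑ j, k j * (p.2 - p.1) j := by
              rw [← Finset.sum_neg_distrib]
              exact Finset.sum_congr rfl fun j _ => by
                simp only [Prod.snd_swap, Prod.fst_swap, Pi.sub_apply]; ring
            linarith
          · refine le_of_eq_of_le (Finset.sum_congr rfl fun j _ => ?_) h
            simp only [Prod.snd_swap, Prod.fst_swap, Pi.sub_apply]; ring
        linarith [hg0 p]
    · have : 1 < 2 / (d : ℝ) * ∑ j, (p.2 j - p.1 j) ^ 2 := by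
        rw [div_mul_eq_mul_div, lt_div_iff₀ hd']
        linarith
      linarith [hg0 p, hg0 p.swap]
  have hsq (j : Fin d) : Integrable (fun p : (Fin d → ℝ) × (Fin d → ℝ) => (p.2 j - p.1 j) ^ 2)
      ((cubeMeasure d).prod (cubeMeasure d)) :=
    integrable_of_continuous_cubeMeasure (by fun_prop)
  have hmono := integral_mono ((integrable_const (1 : ℝ)).sub
    ((integrable_finsetSum _ fun j _ => hsq j).const_mul (2 / (d : ℝ)))) (hgi.add hgi.swap) hpt
  have hL : ∫ p : (Fin d → ℝ) × (Fin d → ℝ), (1 - 2 / d * ∑ j, (p.2 j - p.1 j) ^ 2)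
      ∂(cubeMeasure d).prod (cubeMeasure d) = 2 / 3 := by
    rw [integral_sub (integrable_const _)
      ((integrable_finsetSum _ fun j _ => hsq j).const_mul _), integral_const_mul,
      integral_finsetSum _ fun j _ => hsq j]
    simp only [integral_sub_sq_cubeMeasure]
    simp
    field_simp
    norm_num
  have hR : ∫ p, (g p + g p.swap) ∂(cubeMeasure d).prod (cubeMeasure d) =
      2 * ∫ u, ∫ v, g (u, v) ∂cubeMeasure d ∂cubeMeasure d := by
    have hgs : Integrable (fun p => g p.swap) ((cubeMeasure d).prod (cubeMeasure d)) := hgi.swap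
    rw [integral_add hgi hgs, integral_prod_swap, integral_prod _ hgi]
    ring
  have := hL.symm.le.trans (hmono.trans hR.le)
  linarith

lemma latticeBallSet_finite (d : ℕ) {r : ℝ} (hr : 0 ≤ r) : (latticeBallSet d r).Finite := by
  refine (Set.finite_Icc (fun _ : Fin d => -⌈r⌉) (fun _ => ⌈r⌉)).subset fun y hy => ?_
  have h (j) : |((y j : ℤ) : ℝ)| ≤ (⌈r⌉ : ℝ) :=
    (abs_apply_le_of_mem_euclideanBall (z := fun j => (y j : ℝ)) hr hy j).trans (Int.le_ceil r)
  exact ⟨fun j => by exact_mod_cast (abs_le.1 (h j)).1,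
    fun j => by exact_mod_cast (abs_le.1 (h j)).2⟩

lemma setIntegral_indicator_add_eq {d : ℕ} {B : Set (Fin d → ℝ)} (hB : MeasurableSet B)
    (w y : Fin d → ℝ) :
    ∫ z in B, (Set.Icc (fun j => w j - 1 / 2) (fun j => w j + 1 / 2)).indicator
        (fun _ => (1 : ℝ)) (y + z) =
      ∫ v, B.indicator (fun _ => (1 : ℝ)) (w + v - y) ∂cubeMeasure d := by
  rw [← setIntegral_Icc_eq_integral_cubeMeasure w
    (fun v => B.indicator (fun _ => (1 : ℝ)) (v - y)), ← integral_indicator hB,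
    ← integral_indicator measurableSet_Icc, ← integral_add_left_eq_self
      (fun v => Set.indicator _ (fun v => B.indicator (fun _ => (1 : ℝ)) (v - y)) v) y]
  congr 1
  ext z
  have h : y + z - y ∈ B ↔ z ∈ B := by rw [add_sub_cancel_left]
  simp only [Set.indicator]
  split_ifs <;> first | rfl | tauto

/-- Near `x`, the integral of the continuous averages of the step extension is a finite
combination of values of `f`, over any finite set large enough to see the whole ball. -/
lemma setIntegral_contBallAvg_stepExt {d : ℕ} {r : ℝ} (hr : 0 ≤ r) (f : (Fin d → ℤ) → ℝ)
    (x : Fin d → ℤ) (S : Finset (Fin d → ℤ))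
    (hS : ∀ w : Fin d → ℤ, (∀ j, |(w j : ℝ) - x j| ≤ r + 1) → w ∈ S) :
    ∫ y in Set.Icc (fun j => (x j : ℝ) - 1 / 2) (fun j => (x j : ℝ) + 1 / 2),
        contBallAvg d r (stepExt d f) y =
      (∑ w ∈ S, f w * ∫ u, ∫ v, (euclideanBall d r).indicator (fun _ => (1 : ℝ))
        ((fun j => (w j : ℝ) - x j) + v - u) ∂cubeMeasure d ∂cubeMeasure d) /
        (volume (euclideanBall d r)).toReal := by
  have hBm := (isClosed_euclideanBall d r).measurableSet
  have hstep (y z : Fin d → ℝ)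
      (hy : y ∈ Set.Icc (fun j => (x j : ℝ) - 1 / 2) (fun j => (x j : ℝ) + 1 / 2))
      (hz : z ∈ euclideanBall d r) :
      stepExt d f (y + z) = ∑ w ∈ S, f w * Set.indicator
        (Set.Icc (fun j => (w j : ℝ) - 1 / 2) (fun j => (w j : ℝ) + 1 / 2))
        (fun _ => (1 : ℝ)) (y + z) := by
    refine tsum_eq_sum fun w hw => ?_
    rw [Set.indicator_of_notMem, mul_zero]
    refine fun hmem => hw (hS w fun j => ?_)
    have h1 := hmem.1 j
    have h2 := hmem.2 j
    have h3 := hy.1 j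
    have h4 := hy.2 j
    have h5 := abs_le.1 (abs_apply_le_of_mem_euclideanBall hr hz j)
    simp only [Pi.add_apply] at h1 h2 h3 h4
    rw [abs_le]
    constructor <;> linarith [h5.1, h5.2]
  have havg : ∀ y ∈ Set.Icc (fun j => (x j : ℝ) - 1 / 2) (fun j => (x j : ℝ) + 1 / 2),
      contBallAvg d r (stepExt d f) y =
        (∑ w ∈ S, f w * ∫ v, (euclideanBall d r).indicator (fun _ => (1 : ℝ))
          ((fun j => (w j : ℝ)) + v - y) ∂cubeMeasure d) /
          (volume (euclideanBall d r)).toReal := by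
    intro y hy
    rw [contBallAvg, setIntegral_congr_fun hBm fun z hz => hstep y z hy hz, integral_finsetSum]
    · simp only [integral_const_mul]
      congr 1
      exact Finset.sum_congr rfl fun w _ => by
        rw [← setIntegral_indicator_add_eq hBm (fun j => (w j : ℝ)) y]
    · intro w _
      have : IsFiniteMeasure (volume.restrict (euclideanBall d r)) :=
        ⟨by simpa using volume_euclideanBall_lt_top d hr⟩
      have hm : MeasurableSet {z : Fin d → ℝ | y + z ∈
          Set.Icc (fun j => (w j : ℝ) - 1 / 2) (fun j => (w j : ℝ) + 1 / 2)} :=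
        (show Measurable fun z : Fin d → ℝ => y + z by fun_prop) measurableSet_Icc
      exact ((integrable_const (1 : ℝ)).indicator hm).const_mul _
  rw [setIntegral_congr_fun measurableSet_Icc havg,
    setIntegral_Icc_eq_integral_cubeMeasure (fun j => (x j : ℝ)), integral_div]
  have harg (w : Fin d → ℤ) (u v : Fin d → ℝ) :
      (fun j => (w j : ℝ)) + v - ((fun j => (x j : ℝ)) + u) =
        (fun j => (w j : ℝ) - x j) + v - u := by
    ext j
    simp only [Pi.add_apply, Pi.sub_apply]
    ring
  simp only [harg]
  rw [integral_finsetSum _ fun w _ =>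
    ((integrable_indicator_add_sub hBm _).integral_prod_left).const_mul _]
  simp only [integral_const_mul]

/-- Inequality (3.16): for `N ≥ C₁ d` with `#(B_N ∩ ℤ^d) ≥ C₂⁻¹ |B_N|`,
nonnegative `f` and `N₂ = (N² + d/2)^{1/2}`,
`M_N^B f(x) ≤ 4 C₂ e^{1/(4C₁²)} ∫_{x + Q_{1/2}} 𝐌_{N₂}^B F(y) dy`. -/
theorem discrete_avg_dominated_by_integral_of_continuous_avg
    (C₁ C₂ : ℝ) (hC₁ : 0 < C₁) (hC₂ : 0 < C₂)
    (d : ℕ) (hd : 1 ≤ d) (N : ℝ) (hN : C₁ * (d : ℝ) ≤ N)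
    (hcard : C₂⁻¹ * (volume (euclideanBall d N)).toReal ≤ ((latticeBallSet d N).ncard : ℝ))
    (f : (Fin d → ℤ) → ℝ) (hf : ∀ y, 0 ≤ f y) (x : Fin d → ℤ) :
    ballAvgR d N f x ≤
      4 * C₂ * Real.exp (1 / (4 * C₁ ^ 2)) *
        ∫ y in Set.Icc (fun j => (x j : ℝ) - 1 / 2) (fun j => (x j : ℝ) + 1 / 2),
          contBallAvg d (Real.sqrt (N ^ 2 + (d : ℝ) / 2)) (stepExt d f) y := by
  have hd' : (0 : ℝ) < d := by exact_mod_cast hd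
  have hN0 : 0 < N := (mul_pos hC₁ hd').trans_le hN
  set r := Real.sqrt (N ^ 2 + (d : ℝ) / 2) with hr
  have hNr : N ≤ r := Real.le_sqrt_of_sq_le (by linarith)
  have hr0 : 0 < r := hN0.trans_le hNr
  have hfin := latticeBallSet_finite d hN0.le
  set K := hfin.toFinset with hK
  let S : Finset (Fin d → ℤ) :=
    Finset.Icc (fun j => x j - ⌈r + 1⌉) (fun j => x j + ⌈r + 1⌉)
  have hS (w : Fin d → ℤ) (hw : ∀ j, |(w j : ℝ) - x j| ≤ r + 1) : w ∈ S := by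
    have h (j) : |w j - x j| ≤ ⌈r + 1⌉ := by
      exact_mod_cast (hw j).trans (Int.le_ceil _)
    exact Finset.mem_Icc.2 ⟨fun j => by linarith [(abs_le.1 (h j)).1],
      fun j => by linarith [(abs_le.1 (h j)).2]⟩
  rw [setIntegral_contBallAvg_stepExt hr0.le f x S hS]
  set I : (Fin d → ℤ) → ℝ := fun w => ∫ u, ∫ v, (euclideanBall d r).indicator (fun _ => (1 : ℝ))
    ((fun j => (w j : ℝ) - x j) + v - u) ∂cubeMeasure d ∂cubeMeasure d with hI
  set V₁ := (volume (euclideanBall d N)).toReal with hV₁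
  set V₂ := (volume (euclideanBall d r)).toReal with hV₂
  have hV₁0 : 0 < V₁ := ENNReal.toReal_pos (volume_euclideanBall_pos d hN0).ne'
    (volume_euclideanBall_lt_top d hN0.le).ne
  have hV₂0 : 0 < V₂ := ENNReal.toReal_pos (volume_euclideanBall_pos d hr0).ne'
    (volume_euclideanBall_lt_top d hr0.le).ne
  have hV : V₂ ≤ Real.exp (1 / (4 * C₁ ^ 2)) * V₁ := volume_euclideanBall_sqrt_le hC₁ hd hN
  have hI0 (w) : 0 ≤ I w := integral_nonneg fun u => integral_nonneg fun v =>
    Set.indicator_nonneg (fun _ _ => zero_le_one) _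
  have hmem (y) (hy : y ∈ K) : (fun j => (y j : ℝ)) ∈ euclideanBall d N := hfin.mem_toFinset.1 hy
  have hIK (y) (hy : y ∈ K) : 1 / 4 ≤ I (x - y) := by
    refine one_div_four_le_integral_indicator hd ?_
    have : ∑ j, (y j : ℝ) ^ 2 ≤ N ^ 2 := hmem y hy
    simpa [euclideanBall] using this
  have hsub : K.image (fun y => x - y) ⊆ S := by
    intro w hw
    obtain ⟨y, hy, rfl⟩ := Finset.mem_image.1 hw
    refine hS _ fun j => ?_
    have := abs_apply_le_of_mem_euclideanBall hN0.le (hmem y hy) j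
    simp only [Pi.sub_apply, Int.cast_sub, sub_sub_cancel_left, abs_neg]
    linarith
  have hsum : (∑ y ∈ K, f (x - y)) / 4 ≤ ∑ w ∈ S, f w * I w := by
    calc (∑ y ∈ K, f (x - y)) / 4 = ∑ y ∈ K, f (x - y) * (1 / 4) := by
          rw [← Finset.sum_mul]; ring
      _ ≤ ∑ y ∈ K, f (x - y) * I (x - y) :=
        Finset.sum_le_sum fun y hy => mul_le_mul_of_nonneg_left (hIK y hy) (hf _)
      _ = ∑ w ∈ K.image (fun y => x - y), f w * I w :=
        (Finset.sum_image (f := fun w => f w * I w)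
          fun a _ b _ h => sub_right_injective h).symm
      _ ≤ ∑ w ∈ S, f w * I w :=
        Finset.sum_le_sum_of_subset_of_nonneg hsub fun w _ _ => mul_nonneg (hf w) (hI0 w)
  have hA : 0 ≤ ∑ y ∈ K, f (x - y) := Finset.sum_nonneg fun y _ => hf _
  rw [ballAvgR, finsum_mem_eq_finite_toFinset_sum _ hfin]
  calc (∑ y ∈ K, f (x - y)) / ((latticeBallSet d N).ncard : ℝ)
      ≤ (∑ y ∈ K, f (x - y)) / (C₂⁻¹ * V₁) :=
        div_le_div_of_nonneg_left hA (by positivity) hcard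
    _ = 4 * C₂ * ((∑ y ∈ K, f (x - y)) / 4 / V₁) := by field_simp
    _ ≤ 4 * C₂ * (Real.exp (1 / (4 * C₁ ^ 2)) * ((∑ y ∈ K, f (x - y)) / 4 / V₂)) := by
        refine mul_le_mul_of_nonneg_left ?_ (by positivity)
        rw [← mul_div_assoc, div_le_div_iff₀ hV₁0 hV₂0]
        nlinarith [mul_le_mul_of_nonneg_left hV (div_nonneg hA (by norm_num : (0 : ℝ) ≤ 4))]
    _ ≤ 4 * C₂ * (Real.exp (1 / (4 * C₁ ^ 2)) * ((∑ w ∈ S, f w * I w) / V₂)) := by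
        gcongr
    _ = _ := by ring
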